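/- arXiv:1612.03191 — 2 statements merged into one kernel-verified Lean document; each statement's English description precedes it below -/
import Mathlib

section
/- Let 𝕀 be an interface and D the dependency relation induced by 𝕀. If p ⊑^𝕀_unc q, then for all s ∈ Act*: p ⇓ [s]_D implies q ⇓ [s]_D. -/
/-!
Common definitions: sequential CCS with success, configurations,
must testing, Mazurkiewicz traces, filtered traces, interfaces, and
the classical / uncoordinated / individualistic must preorders.
-/

namespace MultipartyTesting

/-- Actions: input or output over a name. -/
inductive Act (Name : Type) : Type where
  | inp : Name → Act Name
  | out : Name → Act Name

/-- Complementation of actions (involutive). -/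
def Act.co {Name : Type} : Act Name → Act Name
  | .inp a => .out a
  | .out a => .inp a

/-- Transition labels: visible actions, the internal action τ, and success ✓. -/
inductive Label (Name : Type) : Type where
  | act : Act Name → Label Name
  | tau : Label Name
  | tick : Label Name

/-- Sequential CCS with success (recursion via de Bruijn indices):
`p ::= 0 | 1 | μ.p | p+q | X | rec_X. p` where prefixes are actions (`pre`) or τ (`tpre`). -/
inductive Proc (Name : Type) : Type where
  | nil : Proc Name
  | one : Proc Name
  | pre : Act Name → Proc Name → Proc Name
  | tpre : Proc Name → Proc Name
  | choice : Proc Name → Proc Name → Proc Name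
  | var : ℕ → Proc Name
  | fix : Proc Name → Proc Name

namespace Proc

variable {Name : Type}

/-- de Bruijn lifting. -/
def lift (d : ℕ) : Proc Name → Proc Name
  | nil => nil
  | one => one
  | pre a p => pre a (lift d p)
  | tpre p => tpre (lift d p)
  | choice p q => choice (lift d p) (lift d q)
  | var k => if k < d then var k else var (k + 1)
  | fix p => fix (lift (d + 1) p)

/-- Substitution of `u` for de Bruijn index `d`. -/
def subst (d : ℕ) (u : Proc Name) : Proc Name → Proc Name
  | nil => nil
  | one => one
  | pre a p => pre a (subst d u p)
  | tpre p => tpre (subst d u p)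
  | choice p q => choice (subst d u p) (subst d u q)
  | var k => if k = d then u else if k < d then var k else var (k - 1)
  | fix p => fix (subst (d + 1) (lift 0 u) p)

/-- The set of actions occurring in a process (so `α` or `ᾱ` occurs in `p`
iff the corresponding name is in `n(p)`). -/
def acts : Proc Name → Set (Act Name)
  | nil => ∅
  | one => ∅
  | pre a p => insert a (acts p)
  | tpre p => acts p
  | choice p q => acts p ∪ acts q
  | var _ => ∅
  | fix p => acts p

end Proc

/-- The LTS on sequential processes. -/
inductive Step {Name : Type} : Proc Name → Label Name → Proc Name → Prop where
  | one : Step Proc.one Label.tick Proc.nil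
  | pre (a : Act Name) (p : Proc Name) : Step (Proc.pre a p) (Label.act a) p
  | tpre (p : Proc Name) : Step (Proc.tpre p) Label.tau p
  | choiceL {p l p'} (q) : Step p l p' → Step (Proc.choice p q) l p'
  | choiceR {q l q'} (p) : Step q l q' → Step (Proc.choice p q) l q'
  | fix {p l p'} : Step (Proc.subst 0 (Proc.fix p) p) l p' → Step (Proc.fix p) l p'

/-- Configurations: parallel compositions of processes; additionally
`hide V c` is the projection `c↾V` that hides (turns into τ) every action not in `V`. -/
inductive Conf (Name : Type) : Type where
  | proc : Proc Name → Conf Name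
  | par : Conf Name → Conf Name → Conf Name
  | hide : Set (Act Name) → Conf Name → Conf Name

/-- Pure configurations: parallel compositions of processes (no hiding),
i.e. the configurations of the paper. -/
inductive Conf.Pure {Name : Type} : Conf Name → Prop where
  | proc (p : Proc Name) : Pure (Conf.proc p)
  | par {c d} : Pure c → Pure d → Pure (Conf.par c d)

/-- The LTS on configurations: interleaving of non-✓ labels, synchronization of
complementary actions into τ, simultaneous ✓, and the projection rules. -/
inductive CStep {Name : Type} : Conf Name → Label Name → Conf Name → Prop where
  | proc {p l p'} : Step p l p' → CStep (Conf.proc p) l (Conf.proc p')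
  | parL {c l c'} (d) : CStep c l c' → l ≠ Label.tick →
      CStep (Conf.par c d) l (Conf.par c' d)
  | parR {d l d'} (c) : CStep d l d' → l ≠ Label.tick →
      CStep (Conf.par c d) l (Conf.par c d')
  | sync {c a c' d d'} : CStep c (Label.act a) c' → CStep d (Label.act (Act.co a)) d' →
      CStep (Conf.par c d) Label.tau (Conf.par c' d')
  | tick {c c' d d'} : CStep c Label.tick c' → CStep d Label.tick d' →
      CStep (Conf.par c d) Label.tick (Conf.par c' d')
  | hideV {V : Set (Act Name)} {c a c'} : CStep c (Label.act a) c' → a ∈ V →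
      CStep (Conf.hide V c) (Label.act a) (Conf.hide V c')
  | hideH {V : Set (Act Name)} {c a c'} : CStep c (Label.act a) c' → a ∉ V →
      CStep (Conf.hide V c) Label.tau (Conf.hide V c')
  | hideT {V : Set (Act Name)} {c c'} : CStep c Label.tau c' →
      CStep (Conf.hide V c) Label.tau (Conf.hide V c')

variable {Name : Type}

/-- Weak internal transitions `c ⇒ c'`. -/
def WTau : Conf Name → Conf Name → Prop :=
  Relation.ReflTransGen (fun c c' => CStep c Label.tau c')

/-- Weak visible transition `c ⇒^a c'`. -/
def WAct (c : Conf Name) (a : Act Name) (c' : Conf Name) : Prop :=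
  ∃ c₁ c₂, WTau c c₁ ∧ CStep c₁ (Label.act a) c₂ ∧ WTau c₂ c'

/-- Weak string transition `c ⇒^s c'` for `s ∈ Act*`. -/
inductive WString : Conf Name → List (Act Name) → Conf Name → Prop where
  | nil {c c'} : WTau c c' → WString c [] c'
  | cons {c a c₁ s c'} : WAct c a c₁ → WString c₁ s c' → WString c (a :: s) c'

/-- Traces of a configuration (restricted to strings over `Act`). -/
def Tr (c : Conf Name) : Set (List (Act Name)) := {s | ∃ c', WString c s c'}

/-- Divergence: an infinite sequence of τ-transitions. -/
def Div (c : Conf Name) : Prop :=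
  ∃ f : ℕ → Conf Name, f 0 = c ∧ ∀ n, CStep (f n) Label.tau (f (n + 1))

/-- Convergence. -/
def Conv (c : Conf Name) : Prop := ¬ Div c

/-- Convergence along a string: `c ⇓ s`. -/
def ConvS : Conf Name → List (Act Name) → Prop
  | c, [] => Conv c
  | c, a :: s => Conv c ∧ ∀ c', WAct c a c' → ConvS c' s

/-- `c MUST L`. -/
def MUSTone (c : Conf Name) (L : Set (Act Name)) : Prop :=
  ∀ c', WTau c c' → ∃ a ∈ L, ∃ c'', WAct c' a c''

/-- `P MUST L` for a set of configurations. -/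
def MUSTset (P : Set (Conf Name)) (L : Set (Act Name)) : Prop :=
  ∀ c ∈ P, MUSTone c L

/-- Residuals: `(c after s)`. -/
def after (c : Conf Name) (s : List (Act Name)) : Set (Conf Name) :=
  {c' | WString c s c'}

/-- `c must o`: every maximal τ-computation of `c ‖ o` (tracked componentwise)
contains a state whose observer component has a ✓-transition. -/
def MustPass (c o : Conf Name) : Prop :=
  ∀ cs os : ℕ → Conf Name, cs 0 = c → os 0 = o →
    ((∀ k, CStep (Conf.par (cs k) (os k)) Label.tau (Conf.par (cs (k + 1)) (os (k + 1)))) →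
       ∃ j, ∃ o', CStep (os j) Label.tick o') ∧
    (∀ n : ℕ,
       (∀ k < n, CStep (Conf.par (cs k) (os k)) Label.tau (Conf.par (cs (k + 1)) (os (k + 1)))) →
       (¬ ∃ d, CStep (Conf.par (cs n) (os n)) Label.tau d) →
       ∃ j ≤ n, ∃ o', CStep (os j) Label.tick o')

/-- The classical must preorder `p ⊑_must q` (observers are all configurations
of the paper, i.e. pure configurations). -/
def MustLeq (p q : Proc Name) : Prop :=
  ∀ o : Conf Name, o.Pure → MustPass (Conf.proc p) o → MustPass (Conf.proc q) o

/-- An interface: a partition `{I_i}_{i ∈ 0..n}` of `Act` closed under complementation. -/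
structure Interface (Name : Type) (n : ℕ) where
  part : Fin (n + 1) → Set (Act Name)
  cover : ∀ a, ∃ i, a ∈ part i
  disjoint : ∀ i j, i ≠ j → ∀ a, a ∈ part i → a ∉ part j
  nonempty : ∀ i, (part i).Nonempty
  coClosed : ∀ i a, a ∈ part i → Act.co a ∈ part i

/-- `o₀ ‖ o₁ ‖ … ‖ o_n` as a configuration. -/
def parOfList (p : Proc Name) : List (Proc Name) → Conf Name
  | [] => Conf.proc p
  | q :: qs => Conf.par (Conf.proc p) (parOfList q qs)

/-- The parallel composition of an indexed family of processes. -/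
def parComp {n : ℕ} (os : Fin (n + 1) → Proc Name) : Conf Name :=
  parOfList (os 0) (List.ofFn fun i : Fin n => os i.succ)

/-- The uncoordinated must preorder `p ⊑^𝕀_unc q`. -/
def UncLeq {n : ℕ} (𝕀 : Interface Name n) (p q : Proc Name) : Prop :=
  ∀ os : Fin (n + 1) → Proc Name, (∀ i, Proc.acts (os i) ⊆ 𝕀.part i) →
    MustPass (Conf.proc p) (parComp os) → MustPass (Conf.proc q) (parComp os)

/-- The individualistic must preorder `p ⊑^𝕀_ind q`. -/
def IndLeq {n : ℕ} (𝕀 : Interface Name n) (p q : Proc Name) : Prop :=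
  ∀ os : Fin (n + 1) → Proc Name, (∀ i, Proc.acts (os i) ⊆ 𝕀.part i) →
    ∀ i, MustPass (Conf.hide (𝕀.part i) (Conf.proc p)) (Conf.proc (os i)) →
         MustPass (Conf.hide (𝕀.part i) (Conf.proc q)) (Conf.proc (os i))

/-- One swap of adjacent independent actions (w.r.t. a dependency relation `D`). -/
inductive SwapStep (D : Set (Act Name × Act Name)) :
    List (Act Name) → List (Act Name) → Prop where
  | swap (u v : List (Act Name)) (a b : Act Name) :
      (a, b) ∉ D → SwapStep D (u ++ a :: b :: v) (u ++ b :: a :: v)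

/-- Mazurkiewicz trace equivalence `≡_D`: the least congruence on `Act*`
with `αβ ≡ βα` whenever `(α,β) ∉ D`. -/
def MEquiv (D : Set (Act Name × Act Name)) : List (Act Name) → List (Act Name) → Prop :=
  Relation.EqvGen (SwapStep D)

/-- The dependency relation induced by an interface: `D = ∪_{I∈𝕀} I×I`. -/
def DepOf {n : ℕ} (𝕀 : Interface Name n) : Set (Act Name × Act Name) :=
  {x | ∃ i, x.1 ∈ 𝕀.part i ∧ x.2 ∈ 𝕀.part i}

/-- `c ⇓ [s]_D`. -/
def ConvMC (c : Conf Name) (D : Set (Act Name × Act Name)) (s : List (Act Name)) : Prop :=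
  ∀ t, MEquiv D s t → ConvS c t

/-- `(c after [s]_D)`. -/
def afterMC (c : Conf Name) (D : Set (Act Name × Act Name)) (s : List (Act Name)) :
    Set (Conf Name) :=
  {c' | ∃ t, MEquiv D s t ∧ WString c t c'}

/-- The trace-based characterisation `p ≼^𝕀 q` of the uncoordinated preorder. -/
def TraceLeqUnc {n : ℕ} (𝕀 : Interface Name n) (p q : Proc Name) : Prop :=
  ∀ (s : List (Act Name)) (i : Fin (n + 1)) (L : Set (Act Name)),
    L.Finite → L ⊆ 𝕀.part i → ConvMC (Conf.proc p) (DepOf 𝕀) s →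
      ConvMC (Conf.proc q) (DepOf 𝕀) s ∧
      (MUSTset (afterMC (Conf.proc p) (DepOf 𝕀) s) L →
       MUSTset (afterMC (Conf.proc q) (DepOf 𝕀) s) L)

open Classical in
/-- `s↾I`: the subsequence of `s` consisting of its symbols in `I`. -/
noncomputable def fproj (I : Set (Act Name)) (s : List (Act Name)) : List (Act Name) :=
  s.filter fun a => decide (a ∈ I)

/-- `c ⇓ ⟨s⟩_I`. -/
def ConvFC (c : Conf Name) (I : Set (Act Name)) (s : List (Act Name)) : Prop :=
  ∀ t, fproj I t = fproj I s → ConvS c t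

/-- `(c after ⟨s⟩_I)`. -/
def afterFC (c : Conf Name) (I : Set (Act Name)) (s : List (Act Name)) :
    Set (Conf Name) :=
  {c' | ∃ t, fproj I t = fproj I s ∧ WString c t c'}

/-- The filtered-trace characterisation `p ≼^𝕀_flt q` of the individualistic preorder. -/
def TraceLeqInd {n : ℕ} (𝕀 : Interface Name n) (p q : Proc Name) : Prop :=
  ∀ (i : Fin (n + 1)) (s : List (Act Name)), (∀ a ∈ s, a ∈ 𝕀.part i) →
    ∀ L : Set (Act Name), L.Finite → L ⊆ 𝕀.part i →
      ConvFC (Conf.proc p) (𝕀.part i) s →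
        ConvFC (Conf.proc q) (𝕀.part i) s ∧
        (MUSTset (afterFC (Conf.proc p) (𝕀.part i) s) (L ∪ (𝕀.part i)ᶜ) →
         MUSTset (afterFC (Conf.proc q) (𝕀.part i) s) (L ∪ (𝕀.part i)ᶜ))

/-- A configuration is unsuccessful if it has no ✓-transition. -/
def Unsucc (c : Conf Name) : Prop := ¬ ∃ c', CStep c Label.tick c'

/-- Unsuccessful weak internal transitions: all states passed through are unsuccessful. -/
inductive UTau : Conf Name → Conf Name → Prop where
  | refl {c} : Unsucc c → UTau c c
  | step {c c₁ c'} : Unsucc c → CStep c Label.tau c₁ → UTau c₁ c' → UTau c c'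

/-- Unsuccessful weak visible transition. -/
def UWAct (c : Conf Name) (a : Act Name) (c' : Conf Name) : Prop :=
  ∃ c₁ c₂, UTau c c₁ ∧ CStep c₁ (Label.act a) c₂ ∧ UTau c₂ c'

/-- Unsuccessful weak string transition (an unsuccessful weak computation `c ⇒^s c'`). -/
inductive UWString : Conf Name → List (Act Name) → Conf Name → Prop where
  | nil {c c'} : UTau c c' → UWString c [] c'
  | cons {c a c₁ s c'} : UWAct c a c₁ → UWString c₁ s c' → UWString c (a :: s) c'

theorem Act.co_co (a : Act Name) : a.co.co = a := by cases a <;> rfl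

theorem Act.co_injective : Function.Injective (Act.co (Name := Name)) :=
  Function.LeftInverse.injective Act.co_co

/-! ### Mazurkiewicz traces and projections -/

theorem MEquiv.cons {D : Set (Act Name × Act Name)} {s t : List (Act Name)}
    (h : MEquiv D s t) (a : Act Name) : MEquiv D (a :: s) (a :: t) := by
  induction h with
  | rel _ _ h =>
    obtain ⟨u, v, b, c, hbc⟩ := h
    exact .rel _ _ (.swap (a :: u) v b c hbc)
  | refl => exact .refl _
  | symm _ _ _ ih => exact .symm _ _ ih
  | trans _ _ _ _ _ ih₁ ih₂ => exact .trans _ _ _ ih₁ ih₂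

theorem MEquiv.move_to_front {D : Set (Act Name × Act Name)} {a : Act Name}
    (u v : List (Act Name)) (h : ∀ b ∈ u, (b, a) ∉ D) :
    MEquiv D (u ++ a :: v) (a :: (u ++ v)) := by
  induction u with
  | nil => exact .refl _
  | cons b u ih =>
    refine .trans _ _ _ (MEquiv.cons (ih fun c hc => h c (List.mem_cons_of_mem _ hc)) b) ?_
    exact .rel _ _ (.swap [] (u ++ v) b a (h b List.mem_cons_self))

theorem MEquiv.fproj_eq {n : ℕ} {𝕀 : Interface Name n} {s t : List (Act Name)}
    (h : MEquiv (DepOf 𝕀) s t) (i : Fin (n + 1)) :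
    fproj (𝕀.part i) s = fproj (𝕀.part i) t := by
  induction h with
  | rel _ _ h =>
    obtain ⟨u, v, a, b, hab⟩ := h
    by_cases ha : a ∈ 𝕀.part i <;> by_cases hb : b ∈ 𝕀.part i
    · exact absurd ⟨i, ha, hb⟩ hab
    all_goals simp [fproj, ha, hb]
  | refl => rfl
  | symm _ _ _ ih => exact ih.symm
  | trans _ _ _ _ _ ih₁ ih₂ => exact ih₁.trans ih₂

theorem exists_mequiv_cons_of_fproj_eq_cons {n : ℕ} {𝕀 : Interface Name n}
    {i : Fin (n + 1)} {r w : List (Act Name)} {a : Act Name}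
    (h : fproj (𝕀.part i) r = a :: w) : ∃ r', MEquiv (DepOf 𝕀) r (a :: r') := by
  obtain ⟨u, v, rfl, hu, ha, -⟩ := List.filter_eq_cons_iff.1 h
  refine ⟨u ++ v, MEquiv.move_to_front u v ?_⟩
  rintro b hb ⟨j, hbj, haj⟩
  have hij : i = j := by
    by_contra hij
    exact 𝕀.disjoint i j hij a (by simpa using ha) haj
  exact hu b hb (by simpa [hij] using hbj)

/-! ### Convergence along traces -/

theorem Div.of_tau {c c' : Conf Name} (h : CStep c .tau c') (hd : Div c') : Div c := by
  obtain ⟨f, rfl, hf⟩ := hd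
  refine ⟨fun k => Nat.casesOn k c f, rfl, fun k => ?_⟩
  cases k with
  | zero => exact h
  | succ k => exact hf k

theorem ConvS.conv {c : Conf Name} {s : List (Act Name)} (h : ConvS c s) : Conv c := by
  cases s with
  | nil => exact h
  | cons => exact h.1

theorem ConvS.tau {c c' : Conf Name} {s : List (Act Name)} (h : ConvS c s)
    (hc : CStep c .tau c') : ConvS c' s := by
  have hc' : Conv c' := fun hd => h.conv (hd.of_tau hc)
  cases s with
  | nil => exact hc'
  | cons a s =>
    refine ⟨hc', ?_⟩
    rintro d ⟨c₁, c₂, h₁, h₂, h₃⟩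
    exact h.2 d ⟨c₁, c₂, .head hc h₁, h₂, h₃⟩

theorem ConvMC.conv {c : Conf Name} {D : Set (Act Name × Act Name)} {s : List (Act Name)}
    (h : ConvMC c D s) : Conv c :=
  (h s (.refl _)).conv

theorem ConvMC.tau {c c' : Conf Name} {D : Set (Act Name × Act Name)} {s : List (Act Name)}
    (h : ConvMC c D s) (hc : CStep c .tau c') : ConvMC c' D s :=
  fun t ht => (h t ht).tau hc

theorem ConvMC.of_mequiv {c : Conf Name} {D : Set (Act Name × Act Name)}
    {s t : List (Act Name)} (h : ConvMC c D s) (hst : MEquiv D s t) : ConvMC c D t :=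
  fun u hu => h u (.trans _ _ _ hst hu)

theorem ConvMC.act {c c' : Conf Name} {D : Set (Act Name × Act Name)} {a : Act Name}
    {s : List (Act Name)} (h : ConvMC c D (a :: s)) (hc : CStep c (.act a) c') :
    ConvMC c' D s :=
  fun t ht => (h (a :: t) (ht.cons a)).2 c' ⟨c, c', .refl, hc, .refl⟩

/-! ### Transitions of indexed parallel compositions -/

theorem parComp_succ {n : ℕ} (os : Fin (n + 2) → Proc Name) :
    parComp os = .par (.proc (os 0)) (parComp (Fin.tail os)) := by
  simp [parComp, parOfList, List.ofFn_succ, Fin.tail]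

theorem CStep.parComp_update {n : ℕ} {os : Fin (n + 1) → Proc Name} {i : Fin (n + 1)}
    {l : Label Name} {p : Proc Name} (h : Step (os i) l p) (hl : l ≠ .tick) :
    CStep (parComp os) l (parComp (Function.update os i p)) := by
  induction n with
  | zero =>
    obtain rfl : i = 0 := Fin.eq_zero i
    simpa [parComp, parOfList] using CStep.proc h
  | succ n ih =>
    rw [parComp_succ, parComp_succ]
    cases i using Fin.cases with
    | zero => simpa using CStep.parL _ (CStep.proc h) hl
    | succ i =>
      rw [Fin.tail_update_succ, Function.update_of_ne (Fin.succ_ne_zero i).symm]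
      exact CStep.parR _ (ih (os := Fin.tail os) h) hl

theorem CStep.parComp_tick {n : ℕ} {os : Fin (n + 1) → Proc Name}
    (h : ∀ i, ∃ p, Step (os i) .tick p) : ∃ o, CStep (parComp os) .tick o := by
  induction n with
  | zero =>
    obtain ⟨p, hp⟩ := h 0
    exact ⟨_, .proc hp⟩
  | succ n ih =>
    obtain ⟨p, hp⟩ := h 0
    obtain ⟨o, ho⟩ := ih (os := Fin.tail os) fun i => h i.succ
    rw [parComp_succ]
    exact ⟨_, .tick (.proc hp) ho⟩

theorem CStep.exists_of_parComp_tick {n : ℕ} {os : Fin (n + 1) → Proc Name} {o : Conf Name}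
    (h : CStep (parComp os) .tick o) : ∃ p, Step (os 0) .tick p := by
  cases n with
  | zero =>
    change CStep (.proc (os 0)) _ _ at h
    cases h with
    | proc h => exact ⟨_, h⟩
  | succ n =>
    rw [parComp_succ] at h
    cases h with
    | parL _ _ hl => exact absurd rfl hl
    | parR _ _ hl => exact absurd rfl hl
    | tick h _ =>
      cases h with
      | proc h => exact ⟨_, h⟩

theorem CStep.exists_of_parComp_act {n : ℕ} {os : Fin (n + 1) → Proc Name} {a : Act Name}
    {o : Conf Name} (h : CStep (parComp os) (.act a) o) :
    ∃ i p, Step (os i) (.act a) p ∧ o = parComp (Function.update os i p) := by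
  induction n generalizing o with
  | zero =>
    change CStep (.proc (os 0)) _ _ at h
    cases h with
    | proc h => exact ⟨0, _, h, by simp [parComp, parOfList]⟩
  | succ n ih =>
    rw [parComp_succ] at h
    cases h with
    | parL _ h _ =>
      cases h with
      | proc h => exact ⟨0, _, h, by simp [parComp_succ]⟩
    | parR _ h _ =>
      obtain ⟨i, p, hp, rfl⟩ := ih h
      exact ⟨i.succ, p, hp, by
        rw [parComp_succ, Fin.tail_update_succ,
          Function.update_of_ne (Fin.succ_ne_zero i).symm]⟩

theorem CStep.exists_of_parComp_tau {n : ℕ} {os : Fin (n + 1) → Proc Name} {o : Conf Name}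
    (h : CStep (parComp os) .tau o) :
    (∃ i p, Step (os i) .tau p ∧ o = parComp (Function.update os i p)) ∨
    (∃ i j a p p', i ≠ j ∧ Step (os i) (.act a) p ∧ Step (os j) (.act a.co) p') := by
  induction n generalizing o with
  | zero =>
    change CStep (.proc (os 0)) _ _ at h
    cases h with
    | proc h => exact .inl ⟨0, _, h, by simp [parComp, parOfList]⟩
  | succ n ih =>
    rw [parComp_succ] at h
    cases h with
    | parL _ h _ =>
      cases h with
      | proc h => exact .inl ⟨0, _, h, by simp [parComp_succ]⟩
    | parR _ h _ =>
      obtain ⟨i, p, hp, rfl⟩ | ⟨i, j, a, p, p', hij, hp, hp'⟩ := ih h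
      · exact .inl ⟨i.succ, p, hp, by
          rw [parComp_succ, Fin.tail_update_succ,
            Function.update_of_ne (Fin.succ_ne_zero i).symm]⟩
      · exact .inr ⟨i.succ, j.succ, a, p, p', by simpa using hij, hp, hp'⟩
    | sync h h' =>
      obtain ⟨j, p', hp', -⟩ := h'.exists_of_parComp_act
      cases h with
      | proc h => exact .inr ⟨0, j.succ, _, _, p', (Fin.succ_ne_zero j).symm, h, hp'⟩

theorem sum_sizeOf_update_lt {n : ℕ} {os : Fin n → Proc Name} {i : Fin n} {p : Proc Name}
    (h : sizeOf p < sizeOf (os i)) :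
    ∑ j, sizeOf (Function.update os i p j) < ∑ j, sizeOf (os j) := by
  refine Finset.sum_lt_sum (fun j _ => ?_) ⟨i, Finset.mem_univ _, by simpa using h⟩
  obtain rfl | hj := eq_or_ne j i
  · simpa using h.le
  · simp [hj]

/-! ### Convergence observers -/

/-- The observer testing convergence along `w`: it offers the co-actions of `w` in order,
and may internally give up and succeed at any point. -/
def convObs : List (Act Name) → Proc Name
  | [] => .tpre .one
  | a :: w => .choice (.tpre .one) (.pre a.co (convObs w))

theorem acts_convObs (w : List (Act Name)) :
    (convObs w).acts = {b | ∃ a ∈ w, a.co = b} := by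
  induction w with
  | nil => simp [convObs, Proc.acts]
  | cons a w ih =>
    ext b
    simp [convObs, Proc.acts, ih, eq_comm]

theorem step_convObs_tau (w : List (Act Name)) : Step (convObs w) .tau .one := by
  cases w with
  | nil => exact .tpre _
  | cons => exact .choiceL _ (.tpre _)

theorem step_convObs_cons (a : Act Name) (w : List (Act Name)) :
    Step (convObs (a :: w)) (.act a.co) (convObs w) :=
  .choiceR _ (.pre _ _)

theorem step_convObs {w : List (Act Name)} {l : Label Name} {p : Proc Name}
    (h : Step (convObs w) l p) :
    (l = .tau ∧ p = .one) ∨ ∃ a w', w = a :: w' ∧ l = .act a.co ∧ p = convObs w' := by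
  cases w with
  | nil => cases h; exact .inl ⟨rfl, rfl⟩
  | cons a w =>
    cases h with
    | choiceL _ h => cases h; exact .inl ⟨rfl, rfl⟩
    | choiceR _ h => cases h; exact .inr ⟨a, w, rfl, rfl, rfl⟩

theorem sizeOf_lt_of_step_convObs {w : List (Act Name)} {l : Label Name} {p : Proc Name}
    (h : Step (convObs w) l p) : sizeOf p < sizeOf (convObs w) := by
  obtain ⟨-, rfl⟩ | ⟨a, w', rfl, -, rfl⟩ := step_convObs h
  · cases w <;> simp [convObs]; omega
  · simp [convObs]; omega

theorem not_parComp_convObs_tick {n : ℕ} (w : Fin (n + 1) → List (Act Name)) :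
    ¬ ∃ o, CStep (parComp fun i => convObs (w i)) .tick o := by
  rintro ⟨o, ho⟩
  obtain ⟨p, hp⟩ := ho.exists_of_parComp_tick
  obtain ⟨h, -⟩ | ⟨_, _, -, h, -⟩ := step_convObs hp <;> cases h

/-! ### Converging processes pass -/

/-- `c` converges along a trace class with representative `r`, and each component of the
observer `parComp os` either still tests the projection of `r` or has already succeeded. -/
structure ConvState {n : ℕ} (𝕀 : Interface Name n) (c : Conf Name)
    (os : Fin (n + 1) → Proc Name) (r : List (Act Name)) : Prop where
  conv : ConvMC c (DepOf 𝕀) r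
  obs : ∀ i, os i = convObs (fproj (𝕀.part i) r) ∨ os i = .one

namespace ConvState

variable {n : ℕ} {𝕀 : Interface Name n} {c c' o : Conf Name}
  {os : Fin (n + 1) → Proc Name} {r : List (Act Name)}

theorem step_cases (h : ConvState 𝕀 c os r) {i : Fin (n + 1)} {l : Label Name}
    {p : Proc Name} (hp : Step (os i) l p) (hl : l ≠ .tick) :
    sizeOf p < sizeOf (os i) ∧ ((l = .tau ∧ p = .one) ∨
      ∃ a w, fproj (𝕀.part i) r = a :: w ∧ l = .act a.co ∧ p = convObs w) := by
  obtain hi | hi := h.obs i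
  · rw [hi] at hp ⊢
    exact ⟨sizeOf_lt_of_step_convObs hp, step_convObs hp⟩
  · rw [hi] at hp
    cases hp
    exact absurd rfl hl

theorem mem_part_of_step (h : ConvState 𝕀 c os r) {i : Fin (n + 1)} {a : Act Name}
    {p : Proc Name} (hp : Step (os i) (.act a) p) : a ∈ 𝕀.part i := by
  obtain ⟨-, ⟨⟨⟩, -⟩ | ⟨b, w, hw, hl, -⟩⟩ := h.step_cases hp (by simp)
  have hb : b ∈ fproj (𝕀.part i) r := hw ▸ List.mem_cons_self
  have hb' : b ∈ 𝕀.part i := by simpa using (List.mem_filter.1 hb).2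
  cases hl
  exact 𝕀.coClosed i b hb'

theorem step_tau (h : ConvState 𝕀 c os r) (ho : CStep (parComp os) .tau o) :
    ∃ os', o = parComp os' ∧ ConvState 𝕀 c os' r ∧
      ∑ i, sizeOf (os' i) < ∑ i, sizeOf (os i) := by
  obtain ⟨i, p, hp, rfl⟩ | ⟨i, j, a, p, p', hij, hp, hp'⟩ := ho.exists_of_parComp_tau
  · obtain ⟨hlt, ⟨-, rfl⟩ | ⟨_, _, -, ⟨⟩, -⟩⟩ := h.step_cases hp (by simp)
    refine ⟨_, rfl, ⟨h.conv, fun j => ?_⟩, sum_sizeOf_update_lt hlt⟩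
    obtain rfl | hj := eq_or_ne j i
    · simp
    · simpa [hj] using h.obs j
  · have hj := 𝕀.coClosed j _ (h.mem_part_of_step hp')
    rw [Act.co_co] at hj
    exact absurd hj (𝕀.disjoint i j hij a (h.mem_part_of_step hp))

theorem step_sync (h : ConvState 𝕀 c os r) {a : Act Name} (hc : CStep c (.act a) c')
    (ho : CStep (parComp os) (.act a.co) o) :
    ∃ os' r', o = parComp os' ∧ ConvState 𝕀 c' os' r' ∧
      ∑ i, sizeOf (os' i) < ∑ i, sizeOf (os i) := by
  obtain ⟨i, p, hp, rfl⟩ := ho.exists_of_parComp_act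
  have hai := h.mem_part_of_step hp
  obtain ⟨hlt, ⟨⟨⟩, -⟩ | ⟨b, w, hw, hl, rfl⟩⟩ := h.step_cases hp (by simp)
  obtain rfl : a = b := Act.co_injective (by simpa using hl)
  replace hai : a ∈ 𝕀.part i := Act.co_co a ▸ 𝕀.coClosed i _ hai
  obtain ⟨r', hr'⟩ := exists_mequiv_cons_of_fproj_eq_cons hw
  refine ⟨_, r', rfl, ⟨(h.conv.of_mequiv hr').act hc, fun j => ?_⟩, sum_sizeOf_update_lt hlt⟩
  have hj := hr'.fproj_eq j
  obtain rfl | hji := eq_or_ne j i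
  · rw [hw] at hj
    simp only [fproj, List.filter_cons, hai, decide_true, if_true, List.cons.injEq,
      true_and] at hj
    simp [hj, fproj]
  · have haj : a ∉ 𝕀.part j := 𝕀.disjoint i j hji.symm a hai
    have : fproj (𝕀.part j) r = fproj (𝕀.part j) r' := by
      rw [hj]; simp [fproj, haj]
    simpa [hji, this] using h.obs j

theorem step {o' : Conf Name} (h : ConvState 𝕀 c os r)
    (ho : CStep (.par c (parComp os)) .tau (.par c' o')) :
    (CStep c .tau c' ∧ o' = parComp os ∧ ConvState 𝕀 c' os r) ∨
    ∃ os' r', o' = parComp os' ∧ ConvState 𝕀 c' os' r' ∧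
      ∑ i, sizeOf (os' i) < ∑ i, sizeOf (os i) := by
  cases ho with
  | parL _ hc _ => exact .inl ⟨hc, rfl, h.conv.tau hc, h.obs⟩
  | parR _ ho _ =>
    obtain ⟨os', ho', hs⟩ := h.step_tau ho
    exact .inr ⟨os', r, ho', hs⟩
  | sync hc ho => exact .inr (h.step_sync hc ho)

theorem tick_of_not_tau (h : ConvState 𝕀 c os r) (ho : ¬ ∃ o, CStep (parComp os) .tau o) :
    ∃ o, CStep (parComp os) .tick o := by
  refine CStep.parComp_tick fun i => ?_
  obtain hi | hi := h.obs i
  · exact absurd ⟨_, CStep.parComp_update (hi ▸ step_convObs_tau _) (by simp)⟩ ho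
  · exact ⟨.nil, hi ▸ Step.one⟩

theorem not_infinite (m : ℕ) (h : ConvState 𝕀 c os r) (hm : ∑ i, sizeOf (os i) = m)
    (cs os' : ℕ → Conf Name) (hcs : cs 0 = c) (hos : os' 0 = parComp os) :
    ¬ ∀ k, CStep (.par (cs k) (os' k)) .tau (.par (cs (k + 1)) (os' (k + 1))) := by
  induction m using Nat.strong_induction_on generalizing c os r cs os' with
  | _ m ih =>
    intro hstep
    have key : ∀ k, os' k = parComp os ∧ ConvState 𝕀 (cs k) os r ∧
        CStep (cs k) .tau (cs (k + 1)) := by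
      have next : ∀ k, os' k = parComp os → ConvState 𝕀 (cs k) os r →
          CStep (cs k) .tau (cs (k + 1)) ∧ os' (k + 1) = parComp os ∧
            ConvState 𝕀 (cs (k + 1)) os r := by
        intro k hk hs
        obtain hgoal | ⟨os₁, r₁, ho₁, hs₁, hlt⟩ := hs.step (hk ▸ hstep k)
        · exact hgoal
        · exact (ih _ (hm ▸ hlt) hs₁ rfl (fun j => cs (k + 1 + j)) (fun j => os' (k + 1 + j))
            rfl ho₁ fun j => hstep (k + 1 + j)).elim
      intro k
      induction k with
      | zero =>
        have h0 : ConvState 𝕀 (cs 0) os r := hcs ▸ h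
        exact ⟨hos, h0, (next 0 hos h0).1⟩
      | succ k ihk =>
        obtain ⟨-, hk, hs⟩ := next k ihk.1 ihk.2.1
        exact ⟨hk, hs, (next _ hk hs).1⟩
    exact h.conv.conv ⟨cs, hcs, fun k => (key k).2.2⟩

theorem mustPass (h : ConvState 𝕀 c os r) : MustPass c (parComp os) := by
  intro cs os' hcs hos
  refine ⟨fun hstep => (h.not_infinite _ rfl cs os' hcs hos hstep).elim, ?_⟩
  intro m hstep hstuck
  have key : ∀ k ≤ m, ∃ os₁ r₁, os' k = parComp os₁ ∧ ConvState 𝕀 (cs k) os₁ r₁ := by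
    intro k
    induction k with
    | zero => exact fun _ => ⟨os, r, hos, hcs ▸ h⟩
    | succ k ih =>
      intro hk
      obtain ⟨os₁, r₁, ho₁, hs₁⟩ := ih (by omega)
      obtain ⟨-, ho₂, hs₂⟩ | ⟨os₂, r₂, ho₂, hs₂, -⟩ := hs₁.step (ho₁ ▸ hstep k hk)
      · exact ⟨_, _, ho₂, hs₂⟩
      · exact ⟨_, _, ho₂, hs₂⟩
  obtain ⟨os₁, r₁, ho₁, hs₁⟩ := key m le_rfl
  refine ⟨m, le_rfl, ?_⟩
  rw [ho₁] at hstuck ⊢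
  exact hs₁.tick_of_not_tau fun ⟨o, ho⟩ => hstuck ⟨_, .parR _ ho (by simp)⟩

end ConvState

/-! ### Non-converging processes fail -/

/-- `c ‖ o` has an infinite computation along which the observer never succeeds. -/
def FailsForever (c o : Conf Name) : Prop :=
  ∃ cs os : ℕ → Conf Name, cs 0 = c ∧ os 0 = o ∧
    (∀ k, CStep (.par (cs k) (os k)) .tau (.par (cs (k + 1)) (os (k + 1)))) ∧
    ∀ k, ¬ ∃ o', CStep (os k) .tick o'

namespace FailsForever

variable {c c' o o' : Conf Name}

theorem not_mustPass (h : FailsForever c o) : ¬ MustPass c o := by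
  obtain ⟨cs, os, hcs, hos, hstep, hticks⟩ := h
  intro hm
  obtain ⟨j, hj⟩ := (hm cs os hcs hos).1 hstep
  exact hticks j hj

theorem of_div (h : Div c) (ho : ¬ ∃ o', CStep o .tick o') : FailsForever c o := by
  obtain ⟨f, hf, hstep⟩ := h
  exact ⟨f, fun _ => o, hf, rfl, fun k => .parL _ (hstep k) (by simp), fun _ => ho⟩

theorem of_step (h : FailsForever c' o') (hs : CStep (.par c o) .tau (.par c' o'))
    (ho : ¬ ∃ o', CStep o .tick o') : FailsForever c o := by
  obtain ⟨cs, os, rfl, rfl, hstep, hticks⟩ := h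
  refine ⟨fun k => Nat.casesOn k c cs, fun k => Nat.casesOn k o os, rfl, rfl,
    fun k => ?_, fun k => ?_⟩
  · cases k with
    | zero => exact hs
    | succ k => exact hstep k
  · cases k with
    | zero => exact ho
    | succ k => exact hticks k

theorem of_wtau (hw : WTau c c') (h : FailsForever c' o)
    (ho : ¬ ∃ o', CStep o .tick o') : FailsForever c o := by
  induction hw using Relation.ReflTransGen.head_induction_on with
  | refl => exact h
  | head hs _ ih => exact ih.of_step (.parL _ hs (by simp)) ho

end FailsForever

theorem failsForever_of_not_convS {n : ℕ} (𝕀 : Interface Name n) {c : Conf Name}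
    {t : List (Act Name)} (h : ¬ ConvS c t) :
    FailsForever c (parComp fun i => convObs (fproj (𝕀.part i) t)) := by
  induction t generalizing c with
  | nil => exact .of_div (not_not.1 h) (not_parComp_convObs_tick _)
  | cons a t ih =>
    by_cases hd : Div c
    · exact .of_div hd (not_parComp_convObs_tick _)
    · obtain ⟨c', ⟨c₁, c₂, h₁, h₂, h₃⟩, hc'⟩ : ∃ c', WAct c a c' ∧ ¬ ConvS c' t := by
        by_contra! hcon
        exact h ⟨hd, hcon⟩
      obtain ⟨i, hi⟩ := 𝕀.cover a
      have hcons : fproj (𝕀.part i) (a :: t) = a :: fproj (𝕀.part i) t := by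
        simp [fproj, hi]
      have hobs : CStep (parComp fun j => convObs (fproj (𝕀.part j) (a :: t))) (.act a.co)
          (parComp fun j => convObs (fproj (𝕀.part j) t)) := by
        convert CStep.parComp_update (os := fun j => convObs (fproj (𝕀.part j) (a :: t)))
          (i := i) (hcons ▸ step_convObs_cons a _) (by simp) using 2
        funext j
        obtain rfl | hj := eq_or_ne j i
        · simp
        · have haj : a ∉ 𝕀.part j := 𝕀.disjoint i j hj.symm a hi
          simp [hj, fproj, haj]
      have hfail := FailsForever.of_wtau h₃ (ih hc') (not_parComp_convObs_tick _)
      exact .of_wtau h₁ (hfail.of_step (.sync h₂ hobs) (not_parComp_convObs_tick _))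
        (not_parComp_convObs_tick _)

/-- if `p ⊑^𝕀_unc q` then `p ⇓ [s]_D` implies `q ⇓ [s]_D`. -/
theorem uncLeq_convergence (Name : Type) [Countable Name] {n : ℕ}
    (𝕀 : Interface Name n) (p q : Proc Name) (h : UncLeq 𝕀 p q)
    (s : List (Act Name)) (hp : ConvMC (Conf.proc p) (DepOf 𝕀) s) :
    ConvMC (Conf.proc q) (DepOf 𝕀) s := by
  intro t ht
  by_contra hq
  refine (failsForever_of_not_convS 𝕀 hq).not_mustPass (h _ (fun i => ?_) ?_)
  · rw [acts_convObs]
    rintro _ ⟨a, ha, rfl⟩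
    exact 𝕀.coClosed i a (by simpa using (List.mem_filter.1 ha).2)
  · exact ConvState.mustPass ⟨hp.of_mequiv ht, fun _ => .inl rfl⟩

end MultipartyTesting
end

section
/- For every process p, set of observable names I, and string s ∈ Act*: if p ⇑ ⟨s⟩_I (i.e., there exists t ∈ ⟨s⟩_I with p ⇑ t, where p ⇑ t means not p ⇓ t), then p↾I ⇑ (s↾I). -/
/-!
Common definitions: sequential CCS with success, configurations,
must testing, Mazurkiewicz traces, filtered traces, interfaces, and
the classical / uncoordinated / individualistic must preorders.
-/

namespace MultipartyTesting

variable {Name : Type}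

theorem Div.of_step {c d : Conf Name} (hcd : CStep c Label.tau d) (hd : Div d) : Div c := by
  obtain ⟨f, h0, hf⟩ := hd
  refine ⟨fun n => Nat.casesOn n c f, rfl, fun n => ?_⟩
  cases n with
  | zero => simpa [h0] using hcd
  | succ n => exact hf n

theorem Div.of_wTau {c d : Conf Name} (hcd : WTau c d) (hd : Div d) : Div c := by
  induction hcd using Relation.ReflTransGen.head_induction_on with
  | refl => exact hd
  | head h _ ih => exact ih.of_step h

theorem Div.hide {c : Conf Name} (V : Set (Act Name)) (hc : Div c) : Div (Conf.hide V c) := by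
  obtain ⟨f, rfl, hf⟩ := hc
  exact ⟨fun n => Conf.hide V (f n), rfl, fun n => .hideT (hf n)⟩

theorem WTau.hide {c d : Conf Name} (V : Set (Act Name)) (h : WTau c d) :
    WTau (Conf.hide V c) (Conf.hide V d) :=
  Relation.ReflTransGen.lift (Conf.hide V) (fun _ _ => CStep.hideT) _ _ h

theorem WAct.hide_of_mem {c d : Conf Name} {a : Act Name} {V : Set (Act Name)}
    (h : WAct c a d) (ha : a ∈ V) : WAct (Conf.hide V c) a (Conf.hide V d) := by
  obtain ⟨c₁, c₂, h₁, h₂, h₃⟩ := h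
  exact ⟨_, _, h₁.hide V, .hideV h₂ ha, h₃.hide V⟩

theorem WAct.hide_of_notMem {c d : Conf Name} {a : Act Name} {V : Set (Act Name)}
    (h : WAct c a d) (ha : a ∉ V) : WTau (Conf.hide V c) (Conf.hide V d) := by
  obtain ⟨c₁, c₂, h₁, h₂, h₃⟩ := h
  exact ((h₁.hide V).tail (.hideH h₂ ha)).trans (h₃.hide V)

theorem ConvS.of_wTau {c d : Conf Name} {s : List (Act Name)} (hcd : WTau c d)
    (h : ConvS c s) : ConvS d s := by
  have hd : Conv d := fun hd => h.conv (hd.of_wTau hcd)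
  cases s with
  | nil => exact hd
  | cons a s =>
    refine ⟨hd, fun c' ⟨c₁, c₂, h₁, h₂, h₃⟩ => h.2 c' ⟨c₁, c₂, ?_, h₂, h₃⟩⟩
    exact Relation.ReflTransGen.trans hcd h₁

theorem ConvS.of_hide {V : Set (Act Name)} {t : List (Act Name)} {c : Conf Name}
    (h : ConvS (Conf.hide V c) (fproj V t)) : ConvS c t := by
  have hc : Conv c := fun hc => h.conv (hc.hide V)
  induction t generalizing c with
  | nil => exact hc
  | cons a t ih =>
    have key : ∀ {c' : Conf Name}, ConvS (Conf.hide V c') (fproj V t) → ConvS c' t :=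
      fun h' => ih h' fun hd => h'.conv (hd.hide V)
    refine ⟨hc, fun c' hc' => key ?_⟩
    by_cases ha : a ∈ V
    · have h' : ConvS (Conf.hide V c) (a :: fproj V t) := by simpa [fproj, ha] using h
      exact h'.2 _ (hc'.hide_of_mem ha)
    · have h' : ConvS (Conf.hide V c) (fproj V t) := by simpa [fproj, ha] using h
      exact h'.of_wTau (hc'.hide_of_notMem ha)

/-- if `p ⇑ ⟨s⟩_V` (some `t ∈ ⟨s⟩_V` with `p ⇑ t`) then `p↾V ⇑ (s↾V)`. -/
theorem hide_divergence (Name : Type) [Countable Name]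
    (V : Set (Act Name)) (hV : ∀ a ∈ V, Act.co a ∈ V)
    (p : Proc Name) (s : List (Act Name))
    (h : ∃ t, fproj V t = fproj V s ∧ ¬ ConvS (Conf.proc p) t) :
    ¬ ConvS (Conf.hide V (Conf.proc p)) (fproj V s) := by
  obtain ⟨t, hts, ht⟩ := h
  exact fun hs => ht (ConvS.of_hide (hts ▸ hs))

end MultipartyTesting
end
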